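/- Let H be a complex Hilbert space and let A = C + T be a compact operator, where C is a non-negative compact operator such that lim_{n→∞} s_n(C)/L(n) = a for some slowly varying function L and some constant 0 < a < ∞, and T belongs to the Schatten–von Neumann class S_q for some q > 0. Then A cannot be a Volterra operator; that is, A has at least one nonzero eigenvalue. -/

import Mathlib

open Filter Topology

/-- The `n`-th singular value (`s`-number) of an operator on a Hilbert space,
indexed so that `sNum T 1 = ‖T‖` is the first singular value: `sNum T n` is the
distance from `T` to the operators of rank `< n`. -/
noncomputable def sNum {H : Type*} [NormedAddCommGroup H] [InnerProductSpace ℂ H]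
    (T : H →L[ℂ] H) (n : ℕ) : ℝ :=
  ⨅ F : {F : H →L[ℂ] H // Module.rank ℂ (LinearMap.range (F : H →ₗ[ℂ] H)) < (n : Cardinal)},
    ‖T - (F : H →L[ℂ] H)‖

/-- `L : [b, ∞) → ℝ` (with `b > 0`) is slowly varying if it is positive,
continuously differentiable, and `x * L' x / L x → 0` as `x → ∞`. -/
structure SlowlyVarying (b : ℝ) (L : ℝ → ℝ) : Prop where
  b_pos : 0 < b
  pos : ∀ x, b ≤ x → 0 < L x
  contDiff : ContDiffOn ℝ 1 L (Set.Ici b)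
  slow : Tendsto (fun x : ℝ => x * deriv L x / L x) atTop (𝓝 0)

section SNumBasics
universe u
variable {H K : Type u} [NormedAddCommGroup H] [InnerProductSpace ℂ H]
  [NormedAddCommGroup K] [InnerProductSpace ℂ K]

lemma card_lt_succ (c : Cardinal) (n : ℕ) : c < ((n + 1 : ℕ) : Cardinal) ↔ c ≤ n := by
  rw [Nat.cast_add, Nat.cast_one, ← Cardinal.succ_natCast, Order.lt_succ_iff]

lemma sNum_bdd (T : H →L[ℂ] H) (n : ℕ) : BddBelow (Set.range
    (fun F : {F : H →L[ℂ] H // Module.rank ℂ (LinearMap.range (F : H →ₗ[ℂ] H)) < (n : Cardinal)} =>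
    ‖T - (F : H →L[ℂ] H)‖)) := ⟨0, by rintro _ ⟨F, rfl⟩; exact norm_nonneg _⟩

lemma sNum_nonneg (T : H →L[ℂ] H) (n : ℕ) : 0 ≤ sNum T n :=
  Real.iInf_nonneg fun _ => norm_nonneg _

lemma sNum_le (T F : H →L[ℂ] H) (n : ℕ) (hF : LinearMap.rank (F : H →ₗ[ℂ] H) ≤ n) :
    sNum T (n + 1) ≤ ‖T - F‖ :=
  ciInf_le (sNum_bdd T (n + 1)) ⟨F, (card_lt_succ _ n).2 hF⟩

lemma exists_of_sNum_lt (T : H →L[ℂ] H) (n : ℕ) (r : ℝ) (h : sNum T (n + 1) < r) :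
    ∃ F : H →L[ℂ] H, LinearMap.rank (F : H →ₗ[ℂ] H) ≤ n ∧ ‖T - F‖ < r := by
  have : Nonempty {F : H →L[ℂ] H // Module.rank ℂ (LinearMap.range (F : H →ₗ[ℂ] H)) < ((n + 1 : ℕ) : Cardinal)} :=
    ⟨⟨0, by rw [card_lt_succ]; simp⟩⟩
  obtain ⟨F, hF⟩ := exists_lt_of_ciInf_lt h
  exact ⟨F.1, (card_lt_succ _ n).1 F.2, hF⟩

lemma le_sNum (T : H →L[ℂ] H) (n : ℕ) (r : ℝ)
    (h : ∀ F : H →L[ℂ] H, LinearMap.rank (F : H →ₗ[ℂ] H) ≤ n → r ≤ ‖T - F‖) : r ≤ sNum T (n + 1) := by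
  by_contra hc
  push Not at hc
  obtain ⟨F, h1, h2⟩ := exists_of_sNum_lt T n r hc
  exact absurd (h F h1) (not_le.2 h2)

lemma sNum_anti (T : H →L[ℂ] H) {m n : ℕ} (h : m ≤ n) : sNum T (n + 1) ≤ sNum T (m + 1) :=
  le_sNum _ _ _ fun F hF => sNum_le T F n (hF.trans (by exact_mod_cast h))

lemma sNum_sub_le (S T : H →L[ℂ] H) (n : ℕ) : sNum T (n + 1) ≤ ‖T - S‖ + sNum S (n + 1) := by
  rw [← sub_le_iff_le_add']
  refine le_sNum _ _ _ fun F hF => ?_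
  have := sNum_le T F n hF
  have h2 : ‖T - F‖ ≤ ‖T - S‖ + ‖S - F‖ := norm_sub_le_norm_sub_add_norm_sub _ _ _
  linarith

lemma sNum_add (S T : H →L[ℂ] H) (m n : ℕ) :
    sNum (S + T) (m + n + 1) ≤ sNum S (m + 1) + sNum T (n + 1) := by
  rw [← sub_le_iff_le_add']
  refine le_sNum _ _ _ fun G hG => ?_
  rw [sub_le_comm]
  refine le_sNum _ _ _ fun F hF => ?_
  rw [sub_le_iff_le_add]
  refine (sNum_le (S + T) (F + G) (m + n) ?_).trans ?_
  · push_cast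
    exact (LinearMap.rank_add_le _ _).trans (add_le_add hF hG)
  · rw [add_sub_add_comm]; exact norm_add_le _ _

lemma le_mul_of_forall_gt {r a b : ℝ} (_ha : 0 ≤ a) (_hb : 0 ≤ b)
    (h : ∀ x y, a < x → b < y → r ≤ x * y) : r ≤ a * b := by
  have h1 : Tendsto (fun ε : ℝ => (a + ε) * (b + ε)) (𝓝[>] 0) (𝓝 ((a + 0) * (b + 0))) := by
    apply Tendsto.mono_left _ nhdsWithin_le_nhds
    apply Continuous.tendsto
    fun_prop
  rw [add_zero, add_zero] at h1
  refine ge_of_tendsto h1 ?_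
  filter_upwards [self_mem_nhdsWithin] with ε hε
  have : (0:ℝ) < ε := hε
  exact h _ _ (by linarith) (by linarith)

lemma sNum_mul (S T : H →L[ℂ] H) (m n : ℕ) :
    sNum (S * T) (m + n + 1) ≤ sNum S (m + 1) * sNum T (n + 1) := by
  refine le_mul_of_forall_gt (sNum_nonneg _ _) (sNum_nonneg _ _) fun x y hx hy => ?_
  obtain ⟨F, hF, hF'⟩ := exists_of_sNum_lt _ _ _ hx
  obtain ⟨G, hG, hG'⟩ := exists_of_sNum_lt _ _ _ hy
  refine (sNum_le (S * T) (F * T + (S - F) * G) (m + n) ?_).trans ?_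
  · push_cast
    refine (LinearMap.rank_add_le _ _).trans (add_le_add ?_ ?_)
    · exact (LinearMap.rank_comp_le_left _ _).trans hF
    · exact (LinearMap.rank_comp_le_right _ _).trans hG
  · have : S * T - (F * T + (S - F) * G) = (S - F) * (T - G) := by noncomm_ring
    rw [this]
    exact (norm_mul_le _ _).trans (mul_le_mul hF'.le hG'.le (norm_nonneg _) ((norm_nonneg _).trans hF'.le))

lemma sNum_comp (T : H →L[ℂ] H) (R : H →L[ℂ] K) (S : K →L[ℂ] H) (n : ℕ)
    (hR : ‖R‖ ≤ 1) (hS : ‖S‖ ≤ 1) :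
    sNum (R.comp (T.comp S)) (n + 1) ≤ sNum T (n + 1) := by
  refine le_sNum _ _ _ fun F hF => ?_
  refine (sNum_le _ (R.comp (F.comp S)) n ?_).trans ?_
  · exact ((LinearMap.rank_comp_le_right _ _).trans (LinearMap.rank_comp_le_left _ _)).trans hF
  · have : R.comp (T.comp S) - R.comp (F.comp S) = R.comp ((T - F).comp S) := by
      ext; simp
    rw [this]
    calc _ ≤ ‖R‖ * (‖T - F‖ * ‖S‖) := (ContinuousLinearMap.opNorm_comp_le _ _).trans
            (by gcongr; exact ContinuousLinearMap.opNorm_comp_le _ _)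
      _ ≤ 1 * (‖T - F‖ * 1) := by gcongr
      _ = _ := by ring

lemma sNum_smul (T : H →L[ℂ] H) (c : ℂ) (hc : ‖c‖ ≤ 1) (n : ℕ) :
    sNum (c • T) (n + 1) ≤ sNum T (n + 1) := by
  have := sNum_comp T (c • ContinuousLinearMap.id ℂ H) (ContinuousLinearMap.id ℂ H) n
    (by
      rw [norm_smul]
      exact mul_le_one₀ hc (norm_nonneg _) ContinuousLinearMap.norm_id_le)
    ContinuousLinearMap.norm_id_le
  simpa using this

lemma sNum_zero_of_rank (T : H →L[ℂ] H) (n : ℕ) (h : LinearMap.rank (T : H →ₗ[ℂ] H) ≤ n) :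
    sNum T (n + 1) = 0 :=
  le_antisymm (by simpa using sNum_le T T n h) (sNum_nonneg _ _)

lemma sNum_le_norm (T : H →L[ℂ] H) (n : ℕ) : sNum T (n + 1) ≤ ‖T‖ := by
  simpa using sNum_le T 0 n (by simp)

lemma rank_adjoint_le [CompleteSpace H] (F : H →L[ℂ] H) (n : ℕ)
    (h : LinearMap.rank (F : H →ₗ[ℂ] H) ≤ n) :
    LinearMap.rank (ContinuousLinearMap.adjoint F : H →ₗ[ℂ] H) ≤ n := by
  have hfin : FiniteDimensional ℂ (LinearMap.range (F : H →ₗ[ℂ] H)) := by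
    apply Module.rank_lt_aleph0_iff.1
    exact lt_of_le_of_lt h (Cardinal.natCast_lt_aleph0)
  set R := LinearMap.range (F : H →ₗ[ℂ] H) with hR
  have : ContinuousLinearMap.adjoint F = (ContinuousLinearMap.adjoint F).comp R.starProjection := by
    ext y
    refine ext_inner_right ℂ fun x => ?_
    rw [ContinuousLinearMap.comp_apply, ContinuousLinearMap.adjoint_inner_left,
      ContinuousLinearMap.adjoint_inner_left]
    have := R.starProjection_inner_eq_zero y (F x) ⟨x, rfl⟩
    rw [inner_sub_left, sub_eq_zero] at this
    exact this
  rw [this]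
  refine (LinearMap.rank_comp_le_right (R.starProjection : H →ₗ[ℂ] H) _).trans ?_
  refine le_trans ?_ h
  unfold LinearMap.rank
  apply Submodule.rank_mono
  rintro _ ⟨x, rfl⟩
  exact R.starProjection_apply_mem x

lemma sNum_adjoint_le [CompleteSpace H] (T : H →L[ℂ] H) (n : ℕ) :
    sNum (star T) (n + 1) ≤ sNum T (n + 1) := by
  refine le_sNum _ _ _ fun F hF => ?_
  refine (sNum_le (star T) (star F) n (rank_adjoint_le F n hF)).trans ?_
  rw [← star_sub, norm_star]

end SNumBasics

section Diag
set_option linter.unusedSectionVars false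
universe u
variable {V : Type u} [NormedAddCommGroup V] [InnerProductSpace ℂ V] [FiniteDimensional ℂ V]

lemma diag_inner {n : ℕ} (b : OrthonormalBasis (Fin n) ℂ V) (lam : Fin n → ℂ) (T : V →L[ℂ] V)
    (h : ∀ i, T (b i) = lam i • b i) (v : V) (i : Fin n) :
    inner ℂ (b i) (T v) = lam i * inner ℂ (b i) v := by
  conv_lhs => rw [← b.sum_repr' v]
  simp only [map_sum, map_smul, h, inner_sum, inner_smul_right, b.inner_eq_ite]
  simp [mul_comm]

lemma diag_norm_le {n : ℕ} (b : OrthonormalBasis (Fin n) ℂ V) (lam : Fin n → ℂ) (T : V →L[ℂ] V)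
    (h : ∀ i, T (b i) = lam i • b i) (r : ℝ) (hr : 0 ≤ r) (hl : ∀ i, ‖lam i‖ ≤ r) : ‖T‖ ≤ r := by
  refine T.opNorm_le_bound hr fun v => ?_
  refine le_of_sq_le_sq ?_ (by positivity)
  rw [mul_pow, ← b.sum_sq_norm_inner_right, ← b.sum_sq_norm_inner_right v, Finset.mul_sum]
  refine Finset.sum_le_sum fun i _ => ?_
  rw [diag_inner b lam T h, norm_mul, mul_pow]
  gcongr
  exact hl i

lemma diag_sNum {n : ℕ} (b : OrthonormalBasis (Fin n) ℂ V) (lam : Fin n → ℂ) (T : V →L[ℂ] V)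
    (h : ∀ i, T (b i) = lam i • b i) (ha : Antitone fun i => ‖lam i‖) (k : Fin n) :
    sNum T (k + 1) = ‖lam k‖ := by
  have hdim : Module.finrank ℂ V = n := by
    simpa using Module.finrank_eq_card_basis b.toBasis
  apply le_antisymm
  · set W : Submodule ℂ V := Submodule.span ℂ (b '' {i | i < k}) with hW
    have hP : ∀ i, W.starProjection (b i) = if i < k then b i else 0 := by
      intro i
      split_ifs with hi
      · rw [Submodule.starProjection_eq_self_iff]
        exact Submodule.subset_span ⟨i, hi, rfl⟩
      · have : b i ∈ Wᗮ := by
          rw [Submodule.mem_orthogonal]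
          intro u hu
          induction hu using Submodule.span_induction with
          | mem x hx =>
            obtain ⟨j, hj, rfl⟩ := hx
            rw [b.inner_eq_ite, if_neg]
            rintro rfl; exact hi hj
          | zero => simp
          | add x y _ _ hx hy => rw [inner_add_left, hx, hy, add_zero]
          | smul a x _ hx => rw [inner_smul_left, hx, mul_zero]
        rw [← W.ker_starProjection] at this
        exact this
    refine (sNum_le T (T * W.starProjection) k ?_).trans ?_
    · refine (LinearMap.rank_comp_le_right (W.starProjection : V →ₗ[ℂ] V) _).trans ?_
      have : LinearMap.range (W.starProjection : V →ₗ[ℂ] V) = W := W.range_starProjection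
      unfold LinearMap.rank
      rw [this]
      refine (rank_span_le _).trans ?_
      classical
      have h3 : (b '' {i | i < k}) = ((Finset.univ.filter (· < k)).image b : Finset V) := by
        ext; simp
      rw [h3]
      refine (Cardinal.mk_coe_finset).le.trans ?_
      refine Nat.cast_le.2 (Finset.card_image_le.trans ?_)
      rw [Finset.filter_gt_eq_Iio, Fin.card_Iio]
    · refine diag_norm_le b (fun i => if i < k then 0 else lam i) _ (fun i => ?_) _ (norm_nonneg _)
        (fun i => ?_)
      · change T (b i) - T (W.starProjection (b i)) = _
        rw [hP]
        split_ifs <;> simp [h]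
      · split_ifs with hi
        · simp
        · exact ha (not_lt.1 hi)
  · refine le_sNum _ _ _ fun F hF => ?_
    let Q : V →ₗ[ℂ] (LinearMap.range (F : V →ₗ[ℂ] V)) × ({i : Fin n // k < i} → ℂ) :=
      LinearMap.prod (F : V →ₗ[ℂ] V).rangeRestrict
        (LinearMap.pi fun i => (innerSL ℂ (b i) : V →ₗ[ℂ] ℂ))
    have hF' : Module.finrank ℂ (LinearMap.range (F : V →ₗ[ℂ] V)) ≤ k :=
      Module.finrank_le_of_rank_le hF
    have hk : LinearMap.ker Q ≠ ⊥ := by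
      apply LinearMap.ker_ne_bot_of_finrank_lt
      rw [Module.finrank_prod, Module.finrank_fintype_fun_eq_card, hdim]
      have : Fintype.card {i : Fin n // k < i} = n - 1 - k := by
        rw [Fintype.card_subtype, Finset.filter_lt_eq_Ioi, Fin.card_Ioi]
      rw [this]
      have := k.2
      omega
    obtain ⟨v, hv, hv0⟩ := Submodule.exists_mem_ne_zero_of_ne_bot hk
    have hQ : Q v = 0 := hv
    have hFv : F v = 0 := congrArg Subtype.val (congrArg Prod.fst hQ)
    have hiv : ∀ i, k < i → inner ℂ (b i) v = 0 := fun i hi =>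
      congrFun (congrArg Prod.snd hQ) ⟨i, hi⟩
    have h1 : ‖lam k‖ * ‖v‖ ≤ ‖T v‖ := by
      refine le_of_sq_le_sq ?_ (by positivity)
      rw [mul_pow, ← b.sum_sq_norm_inner_right, ← b.sum_sq_norm_inner_right (T v), Finset.mul_sum]
      refine Finset.sum_le_sum fun i _ => ?_
      rw [diag_inner b lam T h, norm_mul, mul_pow]
      rcases lt_or_ge k i with hi | hi
      · simp [hiv i hi]
      · gcongr
        exact ha hi
    have h2 : ‖T v‖ ≤ ‖T - F‖ * ‖v‖ := by
      have := (T - F).le_opNorm v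
      simpa [hFv] using this
    exact le_of_mul_le_mul_right (h1.trans h2) (norm_pos_iff.2 hv0)

/-- Power sum of s-numbers. -/
noncomputable def phi (p : ℕ) (T : V →L[ℂ] V) : ℝ :=
  ∑ k ∈ Finset.range (Module.finrank ℂ V), sNum T (k + 1) ^ p

lemma phi_nonneg (p : ℕ) (T : V →L[ℂ] V) : 0 ≤ phi p T :=
  Finset.sum_nonneg fun _ _ => pow_nonneg (sNum_nonneg _ _) _

lemma diag_phi {n : ℕ} (b : OrthonormalBasis (Fin n) ℂ V) (lam : Fin n → ℂ) (T : V →L[ℂ] V)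
    (h : ∀ i, T (b i) = lam i • b i) (p : ℕ) : phi p T = ∑ i, ‖lam i‖ ^ p := by
  have hdim : Module.finrank ℂ V = n := by
    simpa using Module.finrank_eq_card_basis b.toBasis
  set σ := Tuple.sort (fun i => -‖lam i‖)
  have hσ : Antitone fun i => ‖lam (σ i)‖ := fun i j hij => by
    simpa using Tuple.monotone_sort (fun i => -‖lam i‖) hij
  have key := diag_sNum (b.reindex σ.symm) (lam ∘ σ) T (fun i => by simp [h]) hσ
  unfold phi
  rw [hdim, ← Fin.sum_univ_eq_sum_range (fun k => sNum T (k + 1) ^ p),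
    ← Equiv.sum_comp σ (fun i => ‖lam i‖ ^ p)]
  exact Finset.sum_congr rfl fun k _ => by rw [key k]; rfl

lemma sNum_pow_le (p : ℕ) (hp : p ≠ 0) (T : V →L[ℂ] V) (k : ℕ) :
    (k + 1) * sNum T (k + 1) ^ p ≤ phi p T := by
  rcases lt_or_ge k (Module.finrank ℂ V) with hk | hk
  · calc (k + 1) * sNum T (k + 1) ^ p = ∑ j ∈ Finset.range (k + 1), sNum T (k + 1) ^ p := by simp
      _ ≤ ∑ j ∈ Finset.range (k + 1), sNum T (j + 1) ^ p := by
        refine Finset.sum_le_sum fun j hj => ?_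
        have : j ≤ k := by simpa [Nat.lt_succ_iff] using hj
        exact pow_le_pow_left₀ (sNum_nonneg _ _) (sNum_anti T this) p
      _ ≤ _ := by
        apply Finset.sum_le_sum_of_subset_of_nonneg
        · simpa using hk
        · intros; exact pow_nonneg (sNum_nonneg _ _) _
  · rw [sNum_zero_of_rank, zero_pow hp, mul_zero]
    · exact phi_nonneg _ _
    · refine (LinearMap.rank_le_domain _).trans ?_
      rw [← Module.finrank_eq_rank]
      exact_mod_cast hk

lemma sum_two {n : ℕ} (f g : ℕ → ℝ) (hf : ∀ k, 0 ≤ f k) (h0 : ∀ k, f (2 * k) ≤ g k)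
    (h1 : ∀ k, f (2 * k + 1) ≤ g k) :
    ∑ k ∈ Finset.range n, f k ≤ 2 * ∑ k ∈ Finset.range n, g k := by
  have h2 : ∑ k ∈ Finset.range (2 * n), f k ≤ 2 * ∑ k ∈ Finset.range n, g k := by
    induction n with
    | zero => simp
    | succ n ih =>
      rw [show 2 * (n + 1) = 2 * n + 1 + 1 by ring, Finset.sum_range_succ, Finset.sum_range_succ,
        Finset.sum_range_succ]
      have := h0 n
      have := h1 n
      linarith
  refine le_trans ?_ h2
  apply Finset.sum_le_sum_of_subset_of_nonneg
  · intro x hx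
    simp only [Finset.mem_range] at *
    omega
  · intros; exact hf _

lemma phi_add (p : ℕ) (S T : V →L[ℂ] V) :
    phi p (S + T) ≤ 2 ^ (p + 1) * (phi p S + phi p T) := by
  have h := sum_two (n := Module.finrank ℂ V) (fun k => sNum (S + T) (k + 1) ^ p)
    (fun k => (sNum S (k + 1) + sNum T (k + 1)) ^ p) (fun k => pow_nonneg (sNum_nonneg _ _) _)
    (fun k => pow_le_pow_left₀ (sNum_nonneg _ _) (by
      have := sNum_add S T k k
      rwa [← two_mul] at this) _)
    (fun k => pow_le_pow_left₀ (sNum_nonneg _ _) (by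
      have := sNum_add S T k k
      rw [← two_mul] at this
      exact (sNum_anti (S + T) (Nat.le_succ (2 * k))).trans this) _)
  refine h.trans ?_
  unfold phi
  rw [← Finset.sum_add_distrib, pow_succ', mul_assoc, Finset.mul_sum (a := (2:ℝ) ^ p)]
  gcongr with k
  have ha := sNum_nonneg S (k + 1)
  have hb := sNum_nonneg T (k + 1)
  set x := sNum S (k + 1)
  set y := sNum T (k + 1)
  rcases le_total x y with hxy | hxy
  · calc (x + y) ^ p ≤ (2 * y) ^ p := by gcongr; linarith
      _ = 2 ^ p * y ^ p := mul_pow _ _ _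
      _ ≤ _ := by gcongr; have := pow_nonneg ha p; linarith
  · calc (x + y) ^ p ≤ (2 * x) ^ p := by gcongr; linarith
      _ = 2 ^ p * x ^ p := mul_pow _ _ _
      _ ≤ _ := by gcongr; have := pow_nonneg hb p; linarith

lemma phi_mul (p : ℕ) (S T : V →L[ℂ] V) :
    phi p (S * T) ≤ 2 * √(phi (2 * p) S * phi (2 * p) T) := by
  have h := sum_two (n := Module.finrank ℂ V) (fun k => sNum (S * T) (k + 1) ^ p)
    (fun k => (sNum S (k + 1) * sNum T (k + 1)) ^ p) (fun k => pow_nonneg (sNum_nonneg _ _) _)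
    (fun k => pow_le_pow_left₀ (sNum_nonneg _ _) (by
      have := sNum_mul S T k k
      rwa [← two_mul] at this) _)
    (fun k => pow_le_pow_left₀ (sNum_nonneg _ _) (by
      have := sNum_mul S T k k
      rw [← two_mul] at this
      exact (sNum_anti (S * T) (Nat.le_succ (2 * k))).trans this) _)
  refine h.trans ?_
  gcongr
  apply Real.le_sqrt_of_sq_le
  unfold phi
  have := Finset.sum_mul_sq_le_sq_mul_sq (Finset.range (Module.finrank ℂ V))
    (fun k => sNum S (k + 1) ^ p) (fun k => sNum T (k + 1) ^ p)
  simp only [← mul_pow, ← pow_mul] at this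
  simpa [mul_comm 2 p] using this

lemma phi_mono (p : ℕ) (S T : V →L[ℂ] V) (h : ∀ k, sNum S (k + 1) ≤ sNum T (k + 1)) :
    phi p S ≤ phi p T :=
  Finset.sum_le_sum fun k _ => pow_le_pow_left₀ (sNum_nonneg _ _) (h k) p

/-- Spectral theorem for self-adjoint operators in finite dimension. -/
lemma exists_diag (X : V →L[ℂ] V) (hX : IsSelfAdjoint X) :
    ∃ (b : OrthonormalBasis (Fin (Module.finrank ℂ V)) ℂ V) (lam : Fin (Module.finrank ℂ V) → ℝ),
      ∀ i, X (b i) = (lam i : ℂ) • b i := by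
  have hs : (X : V →ₗ[ℂ] V).IsSymmetric := hX.isSymmetric
  exact ⟨hs.eigenvectorBasis rfl, hs.eigenvalues rfl, fun i => hs.apply_eigenvectorBasis rfl i⟩

lemma phi_sq (p : ℕ) (X : V →L[ℂ] V) (hX : IsSelfAdjoint X) : phi p (X * X) = phi (2 * p) X := by
  obtain ⟨b, lam, h⟩ := exists_diag X hX
  rw [diag_phi b (fun i => (lam i : ℂ)) X h, diag_phi b (fun i => (lam i : ℂ) ^ 2) (X * X)]
  · simp [pow_mul]
  · intro i
    rw [mul_apply_eq_comp, h, map_smul, h, smul_smul, sq]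

lemma phi_two (X : V →L[ℂ] V) (hX : IsSelfAdjoint X) :
    (phi 2 X : ℂ) = LinearMap.trace ℂ V ((X * X : V →L[ℂ] V) : V →ₗ[ℂ] V) := by
  obtain ⟨b, lam, h⟩ := exists_diag X hX
  rw [diag_phi b (fun i => (lam i : ℂ)) X h, LinearMap.trace_eq_sum_inner _ b]
  push_cast
  refine Finset.sum_congr rfl fun i _ => ?_
  change _ = inner ℂ (b i) (X (X (b i)))
  rw [h, map_smul, h, smul_smul,
    inner_smul_right, b.inner_eq_one, Complex.norm_real, Real.norm_eq_abs, ← Complex.ofReal_pow,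
    sq_abs, sq]
  push_cast; ring

lemma diag_le_phi (p : ℕ) (Y : V →L[ℂ] V) (hY : IsSelfAdjoint Y) {n : ℕ}
    (e : OrthonormalBasis (Fin n) ℂ V) :
    ∑ j, ‖inner ℂ (e j) (Y (e j))‖ ^ p ≤ phi p Y := by
  obtain ⟨b, lam, h⟩ := exists_diag Y hY
  rw [diag_phi b (fun i => (lam i : ℂ)) Y h]
  have h1 : ∀ j, ‖inner ℂ (e j) (Y (e j))‖ ^ p ≤ ∑ i, ‖inner ℂ (b i) (e j)‖ ^ 2 * ‖lam i‖ ^ p := by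
    intro j
    have hw : ∑ i, ‖inner ℂ (b i) (e j)‖ ^ 2 = 1 := by
      rw [b.sum_sq_norm_inner_right]; simp
    have := Real.pow_arith_mean_le_arith_mean_pow Finset.univ
      (fun i => ‖inner ℂ (b i) (e j)‖ ^ 2) (fun i => ‖lam i‖) (fun i _ => by positivity) hw
      (fun i _ => by positivity) p
    refine le_trans (pow_le_pow_left₀ (norm_nonneg _) ?_ p) this
    rw [← b.sum_inner_mul_inner]
    refine (norm_sum_le _ _).trans (Finset.sum_le_sum fun i _ => ?_)
    rw [diag_inner b (fun i => (lam i : ℂ)) Y h, norm_mul, norm_mul, norm_inner_symm]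
    simp
    apply le_of_eq; ring
  calc _ ≤ ∑ j, ∑ i, ‖inner ℂ (b i) (e j)‖ ^ 2 * ‖lam i‖ ^ p := Finset.sum_le_sum fun j _ => h1 j
    _ = ∑ i, (∑ j, ‖inner ℂ (b i) (e j)‖ ^ 2) * ‖lam i‖ ^ p := by
      rw [Finset.sum_comm]; simp_rw [Finset.sum_mul]
    _ = _ := by
      refine Finset.sum_congr rfl fun i _ => ?_
      rw [e.sum_sq_norm_inner_left]; simp

end Diag

section Nilp
set_option linter.unusedSectionVars false
universe u
variable {V : Type u} [NormedAddCommGroup V] [InnerProductSpace ℂ V] [FiniteDimensional ℂ V]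

lemma trace_zero_of_nilp (N : V →L[ℂ] V) (h : IsNilpotent N) :
    LinearMap.trace ℂ V (N : V →ₗ[ℂ] V) = 0 := by
  apply IsNilpotent.eq_zero
  apply LinearMap.isNilpotent_trace_of_isNilpotent
  obtain ⟨k, hk⟩ := h
  refine ⟨k, ?_⟩
  rw [← ContinuousLinearMap.toLinearMap_pow, hk]
  rfl

lemma nilp_base (X Y : V →L[ℂ] V) (hX : IsSelfAdjoint X) (hY : IsSelfAdjoint Y)
    (hN : IsNilpotent (X + Complex.I • Y)) : phi 2 X = phi 2 Y := by
  have hN' : IsNilpotent (X - Complex.I • Y) := by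
    have : IsNilpotent (star (X + Complex.I • Y)) := by
      obtain ⟨k, hk⟩ := hN
      exact ⟨k, by rw [← star_pow, hk, star_zero]⟩
    rwa [star_add, star_smul, hX.star_eq, hY.star_eq, Complex.star_def, Complex.conj_I, neg_smul,
      ← sub_eq_add_neg] at this
  have h1 := trace_zero_of_nilp _ ((Commute.refl _).isNilpotent_mul_left hN :
    IsNilpotent ((X + Complex.I • Y) * (X + Complex.I • Y)))
  have h2 := trace_zero_of_nilp _ ((Commute.refl _).isNilpotent_mul_left hN' :
    IsNilpotent ((X - Complex.I • Y) * (X - Complex.I • Y)))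
  have h3 : (X + Complex.I • Y) * (X + Complex.I • Y) + (X - Complex.I • Y) * (X - Complex.I • Y)
      + 2 * (Y * Y) = 2 * (X * X) := by
    have : (Complex.I • Y) * (Complex.I • Y) = - (Y * Y) := by
      rw [smul_mul_smul_comm, Complex.I_mul_I, neg_one_smul]
    have e : (X + Complex.I • Y) * (X + Complex.I • Y) + (X - Complex.I • Y) * (X - Complex.I • Y)
      + 2 * (Y * Y) = 2 * (X * X) + 2 * ((Complex.I • Y) * (Complex.I • Y)) + 2 * (Y * Y) := by
      generalize Complex.I • Y = Z
      noncomm_ring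
    rw [e, this]; noncomm_ring
  have h4 := congrArg (fun Z : V →L[ℂ] V => LinearMap.trace ℂ V (Z : V →ₗ[ℂ] V)) h3
  simp only [two_mul, ContinuousLinearMap.toLinearMap_add, map_add, h1, h2] at h4
  rw [← phi_two X hX, ← phi_two Y hY] at h4
  have h5 : ((phi 2 Y + phi 2 Y : ℝ) : ℂ) = ((phi 2 X + phi 2 X : ℝ) : ℂ) := by
    push_cast; linear_combination h4
  have := Complex.ofReal_injective h5
  linarith

lemma arith_aux (u v α β : ℝ) (hu : 0 ≤ u) (hv : 0 ≤ v) (h : u ≤ α * √(u * v) + β * v) :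
    u ≤ (α ^ 2 + 2 * β) * v := by
  rw [Real.sqrt_mul hu] at h
  have h1 := Real.sq_sqrt hu
  have h2 := Real.sq_sqrt hv
  nlinarith [sq_nonneg (√u - α * √v)]

/-- Re of a nilpotent is controlled by Im in every `S_{2^m}`. -/
lemma nilp_bound (m : ℕ) : ∃ c : ℝ, 0 ≤ c ∧
    ∀ (V : Type u) [NormedAddCommGroup V] [InnerProductSpace ℂ V] [FiniteDimensional ℂ V]
      (X Y : V →L[ℂ] V), IsSelfAdjoint X → IsSelfAdjoint Y →
      IsNilpotent (X + Complex.I • Y) → phi (2 ^ (m + 1)) X ≤ c * phi (2 ^ (m + 1)) Y := by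
  induction m with
  | zero =>
    refine ⟨1, zero_le_one, ?_⟩
    intro V _ _ _ X Y hX hY hN
    simpa using (nilp_base X Y hX hY hN).le
  | succ m ih =>
    obtain ⟨c, hc, ih⟩ := ih
    set p := 2 ^ (m + 1) with hp
    set K : ℝ := 2 ^ (p + 1) with hK
    refine ⟨(4 * K * K * c) ^ 2 + 2 * K, by positivity, ?_⟩
    intro V _ _ _ X Y hX hY hN
    rw [pow_succ' 2 (m + 1), ← hp]
    apply arith_aux _ _ _ _ (phi_nonneg _ _) (phi_nonneg _ _)
    have e : (X + Complex.I • Y) * (X + Complex.I • Y) =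
        (X * X - Y * Y) + Complex.I • (X * Y + Y * X) := by
      rw [add_mul, mul_add, mul_add, smul_mul_smul_comm, Complex.I_mul_I, neg_one_smul,
        mul_smul_comm, smul_mul_assoc, smul_add]
      abel
    have hN2 : IsNilpotent ((X * X - Y * Y) + Complex.I • (X * Y + Y * X)) := by
      rw [← e]; exact (Commute.refl _).isNilpotent_mul_left hN
    have s1 : IsSelfAdjoint (X * X - Y * Y) := by
      simp [IsSelfAdjoint, star_sub, star_mul, hX.star_eq, hY.star_eq]
    have s2 : IsSelfAdjoint (X * Y + Y * X) := by
      simp [IsSelfAdjoint, star_add, star_mul, hX.star_eq, hY.star_eq, add_comm]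
    have h1 := ih V _ _ s1 s2 hN2
    have h2 := phi_add p (X * X - Y * Y) (Y * Y)
    rw [sub_add_cancel, phi_sq p X hX, phi_sq p Y hY] at h2
    have h3 := phi_add p (X * Y) (Y * X)
    have h4 := phi_mul p X Y
    have h5 := phi_mul p Y X
    rw [mul_comm (phi (2 * p) Y)] at h5
    rw [← hK] at h2 h3
    have hK0 : 0 < K := by positivity
    have h6 : phi p (X * Y + Y * X) ≤ 4 * K * √(phi (2 * p) X * phi (2 * p) Y) := by
      nlinarith
    have h7 : c * phi p (X * Y + Y * X) ≤ c * (4 * K * √(phi (2 * p) X * phi (2 * p) Y)) := by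
      gcongr
    calc _ ≤ _ := h2
      _ ≤ K * (c * (4 * K * √(phi (2 * p) X * phi (2 * p) Y)) + phi (2 * p) Y) := by
        gcongr; exact h1.trans h7
      _ = _ := by ring

end Nilp

section Schur
universe u
variable {V : Type u} [NormedAddCommGroup V] [InnerProductSpace ℂ V] [FiniteDimensional ℂ V]

lemma schur_aux (A : V →L[ℂ] V) (k : ℕ) (hk : k ≤ Module.finrank ℂ V) :
    ∃ (e : Fin k → V) (d : Fin k → ℂ), Orthonormal ℂ e ∧
      ∀ j, A (e j) - d j • e j ∈ Submodule.span ℂ (e '' {i | i < j}) := by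
  induction k with
  | zero => exact ⟨Fin.elim0, Fin.elim0, by simp [Orthonormal], fun j => j.elim0⟩
  | succ k ih =>
    obtain ⟨e, d, he, hA⟩ := ih (by omega)
    set W := Submodule.span ℂ (Set.range e) with hW
    have hWdim : Module.finrank ℂ W = k := by
      rw [hW, finrank_span_eq_card he.linearIndependent]; simp
    have hWo : Module.finrank ℂ Wᗮ ≠ 0 := by
      have := W.finrank_add_finrank_orthogonal
      omega
    have hnt : Nontrivial Wᗮ := Module.nontrivial_of_finrank_pos (Nat.pos_of_ne_zero hWo)
    let B : Wᗮ →ₗ[ℂ] Wᗮ :=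
      ((Wᗮ.orthogonalProjectionOnto).comp (A.comp Wᗮ.subtypeL) : Wᗮ →L[ℂ] Wᗮ)
    obtain ⟨μ, hμ⟩ := Module.End.exists_eigenvalue B
    obtain ⟨w, hw⟩ := hμ.exists_hasEigenvector
    have hw0 : w ≠ 0 := hw.2
    have hBw : B w = μ • w := hw.apply_eq_smul
    set u : V := ((‖w‖ : ℂ)⁻¹) • (w : V) with hu
    have hun : ‖u‖ = 1 := by
      have : ‖w‖ ≠ 0 := norm_ne_zero_iff.2 hw0
      rw [hu, norm_smul, norm_inv, Complex.norm_real, norm_norm]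
      exact inv_mul_cancel₀ this
    have huW : u ∈ Wᗮ := Submodule.smul_mem _ _ w.2
    have huA : A u - μ • u ∈ W := by
      have h1 : A w - μ • (w : V) ∈ W := by
        have h2 : ((Wᗮ.orthogonalProjectionOnto (A w) : Wᗮ) : V) = μ • (w : V) :=
          congrArg Subtype.val hBw
        have h3 := Wᗮ.sub_starProjection_mem_orthogonal (A w)
        rw [Submodule.orthogonal_orthogonal, Submodule.starProjection_apply, h2] at h3
        exact h3
      rw [hu, map_smul, smul_comm, ← smul_sub]
      exact Submodule.smul_mem _ _ h1
    have hei : ∀ i, inner ℂ (e i) u = 0 := fun i =>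
      (Submodule.mem_orthogonal _ _).1 huW _ (Submodule.subset_span ⟨i, rfl⟩)
    refine ⟨Fin.snoc e u, Fin.snoc d μ, ?_, ?_⟩
    · rw [orthonormal_iff_ite] at he ⊢
      intro i j
      refine Fin.lastCases ?_ (fun i => ?_) i <;> refine Fin.lastCases ?_ (fun j => ?_) j
      · simp [inner_self_eq_norm_sq_to_K, hun]
      · have : Fin.last k ≠ j.castSucc := (Fin.castSucc_lt_last j).ne'
        simp only [Fin.snoc_last, Fin.snoc_castSucc, if_neg this]
        rw [inner_eq_zero_symm]; exact hei j
      · have : i.castSucc ≠ Fin.last k := (Fin.castSucc_lt_last i).ne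
        simp only [Fin.snoc_last, Fin.snoc_castSucc, if_neg this]
        exact hei i
      · simp [he i j]
    · intro j
      refine Fin.lastCases ?_ (fun j => ?_) j
      · simp only [Fin.snoc_last]
        refine Submodule.span_mono ?_ huA
        rintro _ ⟨i, rfl⟩
        exact ⟨i.castSucc, Fin.castSucc_lt_last i, by simp⟩
      · simp only [Fin.snoc_castSucc]
        refine Submodule.span_mono ?_ (hA j)
        rintro _ ⟨i, hi, rfl⟩
        exact ⟨i.castSucc, Fin.castSucc_lt_castSucc_iff.2 hi, by simp⟩

/-- Schur decomposition `A = D + N`. -/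
lemma schur (A : V →L[ℂ] V) :
    ∃ (D N : V →L[ℂ] V) (e : OrthonormalBasis (Fin (Module.finrank ℂ V)) ℂ V)
      (d : Fin (Module.finrank ℂ V) → ℂ), A = D + N ∧ IsNilpotent N ∧
      (∀ i, D (e i) = d i • e i) ∧ (∀ i, inner ℂ (e i) (N (e i)) = 0) ∧
      (∀ i, ∃ v : V, v ≠ 0 ∧ A v = d i • v) := by
  set n := Module.finrank ℂ V with hn
  obtain ⟨e₀, d, he, hA⟩ := schur_aux A n le_rfl
  have hspan : Submodule.span ℂ (Set.range e₀) = ⊤ := by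
    apply he.linearIndependent.span_eq_top_of_card_eq_finrank'
    simp [hn]
  let e : OrthonormalBasis (Fin n) ℂ V := OrthonormalBasis.mk he hspan.ge
  have hee : ∀ i, e i = e₀ i := fun i => by simp [e]
  let D : V →L[ℂ] V := LinearMap.toContinuousLinearMap (e.toBasis.constr ℂ fun i => d i • e₀ i)
  have hD : ∀ i, D (e₀ i) = d i • e₀ i := by
    intro i
    have := e.toBasis.constr_basis ℂ (fun i => d i • e₀ i) i
    rw [OrthonormalBasis.coe_toBasis, hee] at this
    exact this
  let E : ℕ → Submodule ℂ V := fun m => Submodule.span ℂ (e₀ '' {i | i.val < m})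
  have hE0 : E 0 = ⊥ := by simp [E]
  have hEn : E n = ⊤ := by
    rw [← hspan]
    simp [E]
  have hEmono : Monotone E := fun a b hab => Submodule.span_mono (Set.image_mono fun i hi =>
    lt_of_lt_of_le hi hab)
  have hNe : ∀ j : Fin n, (A - D) (e₀ j) ∈ E j := by
    intro j
    change A (e₀ j) - D (e₀ j) ∈ _
    rw [hD]
    exact hA j
  have hNE : ∀ m, ∀ v ∈ E (m + 1), (A - D) v ∈ E m := by
    intro m v hv
    induction hv using Submodule.span_induction with
    | mem x hx =>
      obtain ⟨j, hj, rfl⟩ := hx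
      exact hEmono (Nat.lt_succ_iff.1 hj) (hNe j)
    | zero => simp
    | add x y _ _ hx hy => rw [map_add]; exact Submodule.add_mem _ hx hy
    | smul a x _ hx => rw [map_smul]; exact Submodule.smul_mem _ _ hx
  have hNp : ∀ m, ∀ v ∈ E m, ((A - D) ^ m) v = 0 := by
    intro m
    induction m with
    | zero =>
      intro v hv
      rw [hE0, Submodule.mem_bot] at hv
      simp [hv]
    | succ m ih =>
      intro v hv
      rw [pow_succ]
      exact ih _ (hNE m v hv)
  have horth : ∀ j : Fin n, ∀ v ∈ E j, inner ℂ (e₀ j) v = 0 := by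
    intro j v hv
    induction hv using Submodule.span_induction with
    | mem x hx =>
      obtain ⟨i, hi, rfl⟩ := hx
      have hne : j ≠ i := fun h => by
        subst h
        exact lt_irrefl j.val hi
      exact he.2 hne
    | zero => simp
    | add x y _ _ hx hy => rw [inner_add_right, hx, hy, add_zero]
    | smul a x _ hx => rw [inner_smul_right, hx, mul_zero]
  refine ⟨D, A - D, e, d, by abel, ⟨n, ?_⟩, fun i => by rw [hee, hD], fun i => ?_, fun i => ?_⟩
  · ext v
    exact hNp n v (by rw [hEn]; trivial)
  · rw [hee]
    exact horth i _ (hNe i)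
  · by_contra hcon
    push Not at hcon
    let f : V →ₗ[ℂ] V := (A : V →ₗ[ℂ] V) - d i • LinearMap.id
    have hf : Function.Injective f := by
      rw [injective_iff_map_eq_zero]
      intro v hv
      by_contra hv0
      exact hcon v hv0 (sub_eq_zero.1 hv)
    have hmap : (E (i + 1)).map f ≤ E i := by
      rw [Submodule.map_span_le]
      rintro _ ⟨j, hj, rfl⟩
      change A (e₀ j) - d i • e₀ j ∈ E i
      have hj' : j.val ≤ i.val := Nat.lt_succ_iff.1 hj
      rcases hj'.eq_or_lt with h | h
      · have : j = i := Fin.ext h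
        subst this
        exact hA j
      · have h1 : A (e₀ j) - d i • e₀ j = (A (e₀ j) - d j • e₀ j) + (d j - d i) • e₀ j := by
          rw [sub_smul]; abel
        rw [h1]
        refine Submodule.add_mem _ (hEmono h.le (hA j)) (Submodule.smul_mem _ _ ?_)
        exact Submodule.subset_span ⟨j, h, rfl⟩
    have hlt : E i < E (i + 1) := by
      refine lt_of_le_of_ne (hEmono (Nat.le_succ _)) fun h => ?_
      have h1 : e₀ i ∈ E i := by
        rw [h]; exact Submodule.subset_span ⟨i, Nat.lt_succ_self _, rfl⟩
      have h2 := horth i _ h1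
      have h3 := he.1 i
      rw [inner_self_eq_zero] at h2
      rw [h2, norm_zero] at h3
      exact zero_ne_one h3
    have h1 := Submodule.finrank_lt_finrank_of_lt hlt
    have h2 := Submodule.finrank_mono hmap
    have h3 := (Submodule.equivMapOfInjective f hf (E (i + 1))).finrank_eq
    omega

end Schur

section FinDim
universe u
variable {V : Type u} [NormedAddCommGroup V] [InnerProductSpace ℂ V] [FiniteDimensional ℂ V]

/-- Imaginary part. -/
noncomputable def opIm (Z : V →L[ℂ] V) : V →L[ℂ] V := (-(Complex.I / 2)) • (Z - star Z)

/-- Real part. -/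
noncomputable def opRe (Z : V →L[ℂ] V) : V →L[ℂ] V := (1 / 2 : ℂ) • (Z + star Z)

lemma opIm_sa (Z : V →L[ℂ] V) : IsSelfAdjoint (opIm Z) := by
  unfold opIm IsSelfAdjoint
  rw [star_smul, star_sub, star_star, ← neg_sub Z, smul_neg, ← neg_smul]
  congr 1
  simp [neg_div]

lemma opRe_sa (Z : V →L[ℂ] V) : IsSelfAdjoint (opRe Z) := by
  unfold opRe IsSelfAdjoint
  rw [star_smul, star_add, star_star, add_comm Z]
  congr 1
  simp

lemma opRe_add_opIm (Z : V →L[ℂ] V) : opRe Z + Complex.I • opIm Z = Z := by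
  unfold opRe opIm
  rw [smul_smul]
  have : Complex.I * (-(Complex.I / 2)) = 1 / 2 := by
    linear_combination (-1 / 2) * Complex.I_mul_I
  rw [this, ← smul_add]
  have h : Z + star Z + (Z - star Z) = (2 : ℂ) • Z := by rw [two_smul]; abel
  rw [h, smul_smul]; norm_num

lemma phi_smul (p : ℕ) (T : V →L[ℂ] V) (c : ℂ) (hc : ‖c‖ ≤ 1) : phi p (c • T) ≤ phi p T :=
  phi_mono p _ _ fun k => sNum_smul T c hc k

lemma phi_star (p : ℕ) (T : V →L[ℂ] V) : phi p (star T) ≤ phi p T :=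
  phi_mono p _ _ fun k => sNum_adjoint_le T k

lemma phi_neg (p : ℕ) (T : V →L[ℂ] V) : phi p (-T) ≤ phi p T := by
  have := phi_smul p T (-1) (by simp)
  simpa using this

lemma phi_sub (p : ℕ) (S T : V →L[ℂ] V) :
    phi p (S - T) ≤ 2 ^ (p + 1) * (phi p S + phi p T) := by
  rw [sub_eq_add_neg]
  refine (phi_add p S (-T)).trans ?_
  gcongr
  exact phi_neg p T

lemma phi_opIm (p : ℕ) (T : V →L[ℂ] V) : phi p (opIm T) ≤ 2 ^ (p + 1) * (2 * phi p T) := by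
  unfold opIm
  refine (phi_smul p _ _ (by simp; norm_num)).trans ((phi_sub p _ _).trans ?_)
  rw [two_mul]
  gcongr
  exact phi_star p T

lemma opIm_inner_zero (N : V →L[ℂ] V) (x : V) (h : inner ℂ x (N x) = 0) :
    inner ℂ x (opIm N x) = 0 := by
  have h2 : inner ℂ x ((star N) x) = 0 := by
    rw [ContinuousLinearMap.star_eq_adjoint, ContinuousLinearMap.adjoint_inner_right,
      inner_eq_zero_symm]
    exact h
  change inner ℂ x ((-(Complex.I / 2)) • (N x - (star N) x)) = 0
  rw [inner_smul_right, inner_sub_right, h, h2]; simp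

lemma fd_bound (m : ℕ) : ∃ K : ℝ, 0 ≤ K ∧
    ∀ (V : Type u) [NormedAddCommGroup V] [InnerProductSpace ℂ V] [FiniteDimensional ℂ V]
      (C T : V →L[ℂ] V) (ε : ℝ), IsSelfAdjoint C → 0 ≤ ε →
      (∀ (μ : ℂ) (v : V), v ≠ 0 → (C + T) v = μ • v → ‖μ‖ ≤ ε) →
      ∃ E : V →L[ℂ] V, phi (2 ^ (m + 1)) E ≤ K * phi (2 ^ (m + 1)) T ∧ ‖C - E‖ ≤ ε := by
  obtain ⟨c, hc, hnil⟩ := nilp_bound.{u} m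
  set p := 2 ^ (m + 1) with hp
  set κ : ℝ := 2 ^ (p + 1) with hκ
  have hκ0 : 0 < κ := by positivity
  refine ⟨κ * (κ * ((c + 1) * (4 * κ ^ 2)) + 1), by positivity, ?_⟩
  intro V _ _ _ C T ε hC hε heig
  obtain ⟨D, N, e, d, hA, hN, hD, hN0, hd⟩ := schur (C + T)
  have hCD : C - D = N - T := by
    rw [sub_eq_sub_iff_add_eq_add, hA, add_comm]
  refine ⟨C - D, ?_, ?_⟩
  · have hY : opIm N = opIm T - opIm D := by
      have : N = C + T - D := by rw [hA]; abel
      unfold opIm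
      rw [← smul_sub, this, star_sub, star_add, hC.star_eq]
      congr 1
      abel
    have hDstar : ∀ i, (star D) (e i) = (starRingEnd ℂ) (d i) • e i := by
      intro i
      refine ext_inner_right ℂ fun v => ?_
      rw [ContinuousLinearMap.star_eq_adjoint, ContinuousLinearMap.adjoint_inner_left,
        diag_inner e d D hD, inner_smul_left, Complex.conj_conj]
    have hDe : ∀ i, opIm D (e i) =
        (-(Complex.I / 2) * (d i - (starRingEnd ℂ) (d i))) • e i := by
      intro i
      change (-(Complex.I / 2)) • (D (e i) - (star D) (e i)) = _
      rw [hD, hDstar, ← sub_smul, smul_smul]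
    have hci : ∀ i, (-(Complex.I / 2) * (d i - (starRingEnd ℂ) (d i))) =
        inner ℂ (e i) (opIm T (e i)) := by
      intro i
      have h1 : opIm T = opIm N + opIm D := by rw [hY]; abel
      rw [h1]
      change _ = inner ℂ (e i) (opIm N (e i) + opIm D (e i))
      rw [inner_add_right, opIm_inner_zero N _ (hN0 i), hDe, inner_smul_right, e.inner_eq_one]
      ring
    have hDphi : phi p (opIm D) ≤ phi p (opIm T) := by
      rw [diag_phi e _ (opIm D) hDe]
      simp_rw [hci]
      exact diag_le_phi p _ (opIm_sa T) e
    have h1 : phi p (opIm T) ≤ κ * (2 * phi p T) := phi_opIm p T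
    have h2 : phi p (opIm N) ≤ κ * (phi p (opIm T) + phi p (opIm D)) := by
      rw [hY]; exact phi_sub p _ _
    have h2' : phi p (opIm N) ≤ 4 * κ ^ 2 * phi p T := by
      calc _ ≤ _ := h2
        _ ≤ κ * (κ * (2 * phi p T) + κ * (2 * phi p T)) := by gcongr; exact hDphi.trans h1
        _ = _ := by ring
    have h3 : phi p (opRe N) ≤ c * phi p (opIm N) :=
      hnil V _ _ (opRe_sa N) (opIm_sa N) (by rw [opRe_add_opIm]; exact hN)
    have h4 : phi p N ≤ κ * (phi p (opRe N) + phi p (opIm N)) := by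
      conv_lhs => rw [← opRe_add_opIm N]
      refine (phi_add p _ _).trans ?_
      gcongr
      exact phi_smul p _ _ (by simp)
    have h5 : phi p (N - T) ≤ κ * (phi p N + phi p T) := phi_sub p _ _
    rw [hCD]
    calc _ ≤ _ := h5
      _ ≤ κ * (κ * (c * phi p (opIm N) + phi p (opIm N)) + phi p T) := by
        gcongr; exact h4.trans (by gcongr)
      _ = κ * (κ * ((c + 1) * phi p (opIm N)) + phi p T) := by ring
      _ ≤ κ * (κ * ((c + 1) * (4 * κ ^ 2 * phi p T)) + phi p T) := by gcongr
      _ = _ := by ring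
  · rw [sub_sub_cancel]
    refine diag_norm_le e d D hD ε hε fun i => ?_
    obtain ⟨v, hv, hv'⟩ := hd i
    exact heig _ v hv hv'

end FinDim

section Approx
set_option linter.unusedSectionVars false
universe u
variable {H : Type u} [NormedAddCommGroup H] [InnerProductSpace ℂ H] [CompleteSpace H]

lemma noeig_bound (A : H →L[ℂ] H) (hA : IsCompactOperator A)
    (hno : ∀ (μ : ℂ) (v : H), μ ≠ 0 → v ≠ 0 → A v ≠ μ • v) (ε : ℝ) (hε : 0 < ε) :
    ∃ δ > 0, ∀ B : H →L[ℂ] H, ‖A - B‖ < δ → ∀ (μ : ℂ) (v : H), v ≠ 0 → B v = μ • v → ‖μ‖ ≤ ε := by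
  by_contra hcon
  push Not at hcon
  have hcon' : ∀ n : ℕ, ∃ (μ : ℂ) (v : H), ‖v‖ = 1 ∧ ε < ‖μ‖ ∧ ‖A v - μ • v‖ ≤ 1 / ((n : ℝ) + 1) := by
    intro n
    obtain ⟨B, hB, μ, v, hv, hBv, hμ⟩ := hcon (1 / ((n : ℝ) + 1)) (by positivity)
    have hv' : ‖v‖ ≠ 0 := norm_ne_zero_iff.2 hv
    have hw : ‖((‖v‖ : ℂ)⁻¹) • v‖ = 1 := by
      rw [norm_smul, norm_inv, Complex.norm_real, norm_norm, inv_mul_cancel₀ hv']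
    refine ⟨μ, ((‖v‖ : ℂ)⁻¹) • v, hw, hμ, ?_⟩
    have : A (((‖v‖ : ℂ)⁻¹) • v) - μ • ((‖v‖ : ℂ)⁻¹) • v = (A - B) (((‖v‖ : ℂ)⁻¹) • v) := by
      change _ = A _ - B _
      rw [map_smul B, hBv, smul_comm μ]
    rw [this]
    refine ((A - B).le_opNorm _).trans ?_
    rw [hw, mul_one]
    exact hB.le
  choose μ v hv hμ hr using hcon'
  have hr0 : Tendsto (fun n => A (v n) - μ n • v n) atTop (𝓝 0) :=
    squeeze_zero_norm hr tendsto_one_div_add_atTop_nhds_zero_nat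
  have hμb : ∀ n, μ n ∈ Metric.closedBall (0 : ℂ) (‖A‖ + 1) := by
    intro n
    rw [mem_closedBall_zero_iff]
    have h1 : ‖μ n • v n‖ = ‖μ n‖ := by rw [norm_smul, hv, mul_one]
    have h2 : ‖A (v n)‖ ≤ ‖A‖ := by simpa [hv] using A.le_opNorm (v n)
    have h3 : 1 / ((n : ℝ) + 1) ≤ 1 := by
      rw [div_le_one (by positivity)]; simp
    have h4 : ‖μ n • v n‖ ≤ ‖A (v n)‖ + ‖A (v n) - μ n • v n‖ := by
      have := norm_sub_le (A (v n)) (A (v n) - μ n • v n)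
      rwa [sub_sub_cancel] at this
    have := hr n
    linarith
  have hK : IsCompact (closure (A '' Metric.closedBall 0 1)) :=
    hA.isCompact_closure_image_closedBall 1
  have hmem : ∀ n, (A (v n), μ n) ∈
      (closure (A '' Metric.closedBall 0 1)) ×ˢ (Metric.closedBall (0 : ℂ) (‖A‖ + 1)) := fun n =>
    ⟨subset_closure ⟨v n, by simp [hv], rfl⟩, hμb n⟩
  obtain ⟨⟨y, μ₀⟩, -, φ, hφ, hlim⟩ :=
    (hK.prod (isCompact_closedBall (0 : ℂ) (‖A‖ + 1))).tendsto_subseq hmem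
  have hy : Tendsto (fun n => A (v (φ n))) atTop (𝓝 y) := (continuous_fst.tendsto _).comp hlim
  have hm : Tendsto (fun n => μ (φ n)) atTop (𝓝 μ₀) := (continuous_snd.tendsto _).comp hlim
  have hμ0 : ε ≤ ‖μ₀‖ := ge_of_tendsto hm.norm (Eventually.of_forall fun n => (hμ _).le)
  have hμ00 : μ₀ ≠ 0 := by
    rw [← norm_pos_iff]; linarith
  have hμv : Tendsto (fun n => μ (φ n) • v (φ n)) atTop (𝓝 y) := by
    have := hy.sub (hr0.comp hφ.tendsto_atTop)
    simpa using this
  have hvl : Tendsto (fun n => v (φ n)) atTop (𝓝 (μ₀⁻¹ • y)) := by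
    have := (hm.inv₀ hμ00).smul hμv
    refine this.congr fun n => ?_
    rw [smul_smul, inv_mul_cancel₀, one_smul]
    rw [← norm_pos_iff]
    exact hε.trans (hμ _)
  have hv1 : ‖μ₀⁻¹ • y‖ = 1 := tendsto_nhds_unique hvl.norm (by simp [hv])
  refine hno μ₀ (μ₀⁻¹ • y) hμ00 (by rw [← norm_ne_zero_iff, hv1]; exact one_ne_zero) ?_
  have h1 : Tendsto (fun n => A (v (φ n))) atTop (𝓝 (A (μ₀⁻¹ • y))) :=
    (A.continuous.tendsto _).comp hvl
  rw [tendsto_nhds_unique h1 hy, smul_smul, mul_inv_cancel₀ hμ00, one_smul]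

lemma opNorm_le_of_unit_aux (S : H →L[ℂ] H) {ε : ℝ} (hε : 0 ≤ ε) (h : ∀ x, ‖x‖ = 1 → ‖S x‖ ≤ ε) :
    ‖S‖ ≤ ε := by
  refine S.opNorm_le_bound hε fun v => ?_
  rcases eq_or_ne v 0 with rfl | hv
  · simp
  · have hv' : ‖v‖ ≠ 0 := norm_ne_zero_iff.2 hv
    have hw : ‖((‖v‖ : ℂ)⁻¹) • v‖ = 1 := by
      rw [norm_smul, norm_inv, Complex.norm_real, norm_norm, inv_mul_cancel₀ hv']
    have := h _ hw
    rw [map_smul, norm_smul, norm_inv, Complex.norm_real, norm_norm,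
      inv_mul_le_iff₀ (norm_pos_iff.2 hv)] at this
    linarith

lemma exists_fin_rank (S : H →L[ℂ] H) (hS : IsCompactOperator S) (ε : ℝ) (hε : 0 < ε) :
    ∃ F : H →L[ℂ] H, FiniteDimensional ℂ (LinearMap.range (F : H →ₗ[ℂ] H)) ∧ ‖S - F‖ ≤ ε := by
  have hK : IsCompact (closure (S '' Metric.closedBall 0 1)) :=
    hS.isCompact_closure_image_closedBall 1
  obtain ⟨t, ht, hcov⟩ := Metric.totallyBounded_iff.1 hK.totallyBounded ε hε
  set W := Submodule.span ℂ t with hW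
  have : FiniteDimensional ℂ W := FiniteDimensional.span_of_finite ℂ ht
  refine ⟨W.starProjection.comp S, ?_, ?_⟩
  · refine Submodule.finiteDimensional_of_le (S₂ := W) ?_
    rintro _ ⟨x, rfl⟩
    exact W.starProjection_apply_mem _
  · refine opNorm_le_of_unit_aux _ hε.le fun x hx => ?_
    obtain ⟨y, hy, hxy⟩ := Set.mem_iUnion₂.1 (hcov (subset_closure ⟨x, by simp [hx], rfl⟩))
    change ‖S x - W.starProjection (S x)‖ ≤ ε
    rw [W.starProjection_minimal]
    refine (ciInf_le ⟨0, by rintro _ ⟨z, rfl⟩; exact norm_nonneg _⟩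
      (⟨y, Submodule.subset_span hy⟩ : W)).trans ?_
    rw [Metric.mem_ball, dist_eq_norm] at hxy
    exact hxy.le

lemma proj_approx (S F : H →L[ℂ] H) (U : Submodule ℂ H) [FiniteDimensional ℂ U]
    (h1 : LinearMap.range (F : H →ₗ[ℂ] H) ≤ U)
    (h2 : LinearMap.range ((star F : H →L[ℂ] H) : H →ₗ[ℂ] H) ≤ U) (ε : ℝ)
    (h : ‖S - F‖ ≤ ε) : ‖S - U.starProjection * S * U.starProjection‖ ≤ 2 * ε := by
  set P := U.starProjection with hP
  have hPs : star P = P := isSelfAdjoint_starProjection U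
  have hPn : ‖P‖ ≤ 1 := U.starProjection_norm_le
  have e1 : P * F = F := by
    ext x
    exact U.starProjection_eq_self_iff.2 (h1 ⟨x, rfl⟩)
  have e2 : P * star F = star F := by
    ext x
    exact U.starProjection_eq_self_iff.2 (h2 ⟨x, rfl⟩)
  have e3 : F * P = F := by
    have := congrArg star e2
    rwa [star_mul, star_star, hPs] at this
  have e4 : S - P * S * P = (S - F) - P * (S - F) * P := by
    rw [mul_sub, sub_mul, e1, e3]; abel
  have h5 : ‖P * (S - F) * P‖ ≤ ‖S - F‖ := by
    calc _ ≤ ‖P‖ * ‖S - F‖ * ‖P‖ := (norm_mul_le _ _).trans (by gcongr; exact norm_mul_le _ _)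
      _ ≤ 1 * ‖S - F‖ * 1 := by gcongr
      _ = _ := by ring
  rw [e4]
  refine (norm_sub_le _ _).trans ?_
  linarith

lemma fin_range_star (F : H →L[ℂ] H) (h : FiniteDimensional ℂ (LinearMap.range (F : H →ₗ[ℂ] H))) :
    FiniteDimensional ℂ (LinearMap.range ((star F : H →L[ℂ] H) : H →ₗ[ℂ] H)) := by
  have h1 : LinearMap.rank (F : H →ₗ[ℂ] H) ≤ (Module.finrank ℂ (LinearMap.range (F : H →ₗ[ℂ] H)) : ℕ) := by
    rw [Module.finrank_eq_rank]
  exact Module.rank_lt_aleph0_iff.1 (lt_of_le_of_lt (rank_adjoint_le F _ h1) Cardinal.natCast_lt_aleph0)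

lemma sNum_bound_of_noeig (m : ℕ) (C T : H →L[ℂ] H) (hAc : IsCompactOperator (C + T))
    (hCc : IsCompactOperator C) (hC : IsSelfAdjoint C)
    (hno : ∀ (μ : ℂ) (v : H), μ ≠ 0 → v ≠ 0 → (C + T) v ≠ μ • v) (M : ℝ)
    (hM : ∀ n, ∑ k ∈ Finset.range n, sNum T (k + 1) ^ (2 ^ (m + 1)) ≤ M) :
    ∃ K : ℝ, ∀ k : ℕ, ((k : ℝ) + 1) * sNum C (k + 1) ^ (2 ^ (m + 1)) ≤ K := by
  obtain ⟨K, hK, hfd⟩ := fd_bound.{u} m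
  set p := 2 ^ (m + 1) with hp
  have hp0 : p ≠ 0 := by positivity
  refine ⟨K * M, fun k => ?_⟩
  have key : ∀ ε : ℝ, 0 < ε → ∃ s : ℝ, 0 ≤ s ∧ sNum C (k + 1) ≤ 2 * ε + s ∧
      ((k : ℝ) + 1) * s ^ p ≤ K * M := by
    intro ε hε
    obtain ⟨δ, hδ, hB⟩ := noeig_bound (C + T) hAc hno ε hε
    obtain ⟨F, hF, hFn⟩ := exists_fin_rank (C + T) hAc (δ / 4) (by positivity)
    obtain ⟨G, hG, hGn⟩ := exists_fin_rank C hCc (ε / 2) (by positivity)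
    have hF' := fin_range_star F hF
    have hG' := fin_range_star G hG
    let U : Submodule ℂ H := (LinearMap.range (F : H →ₗ[ℂ] H) ⊔
      LinearMap.range ((star F : H →L[ℂ] H) : H →ₗ[ℂ] H)) ⊔ (LinearMap.range (G : H →ₗ[ℂ] H) ⊔
      LinearMap.range ((star G : H →L[ℂ] H) : H →ₗ[ℂ] H))
    have hU : FiniteDimensional ℂ U := inferInstance
    have hA1 := proj_approx (C + T) F U (le_sup_left.trans le_sup_left)
      (le_sup_right.trans le_sup_left) _ hFn
    have hC1 := proj_approx C G U (le_sup_left.trans le_sup_right)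
      (le_sup_right.trans le_sup_right) _ hGn
    let J : U →L[ℂ] H := U.subtypeL
    let Q : H →L[ℂ] U := U.orthogonalProjectionOnto
    have hJ : ‖J‖ ≤ 1 := U.norm_subtypeL_le
    have hQ : ‖Q‖ ≤ 1 := U.orthogonalProjectionOnto_norm_le
    let C' : U →L[ℂ] U := Q.comp (C.comp J)
    let T' : U →L[ℂ] U := Q.comp (T.comp J)
    have hC' : IsSelfAdjoint C' := by
      rw [ContinuousLinearMap.isSelfAdjoint_iff', ContinuousLinearMap.adjoint_comp,
        ContinuousLinearMap.adjoint_comp, U.adjoint_subtypeL, U.adjoint_orthogonalProjectionOnto,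
        ContinuousLinearMap.isSelfAdjoint_iff'.1 hC]
      rfl
    obtain ⟨E, hE1, hE2⟩ := hfd U C' T' ε hC' hε.le (by
      intro μ v hv hev
      refine hB _ (lt_of_le_of_lt hA1 (by linarith)) μ (v : H) (by simpa using hv) ?_
      have h1 := congrArg Subtype.val hev
      have h2 : U.starProjection (v : H) = v := U.starProjection_eq_self_iff.2 v.2
      change U.starProjection ((C + T) (U.starProjection (v : H))) = μ • (v : H)
      rw [h2]
      have h3 : ((C' + T') v : U) = Q ((C + T) (v : H)) := by
        change Q (C v) + Q (T v) = Q (C v + T v)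
        rw [map_add]
      rw [h3] at h1
      exact h1)
    refine ⟨sNum E (k + 1), sNum_nonneg _ _, ?_, ?_⟩
    · have h1 := sNum_sub_le (U.starProjection * C * U.starProjection) C k
      have h2 : sNum (U.starProjection * C * U.starProjection) (k + 1) ≤ sNum C' (k + 1) :=
        sNum_comp C' J Q k hJ hQ
      have h3 := sNum_sub_le E C' k
      linarith
    · refine (sNum_pow_le p hp0 E k).trans (hE1.trans ?_)
      gcongr
      refine le_trans ?_ (hM (Module.finrank ℂ U))
      refine Finset.sum_le_sum fun j _ => pow_le_pow_left₀ (sNum_nonneg _ _) ?_ _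
      exact sNum_comp T Q J j hQ hJ
  have hlim : Tendsto (fun ε : ℝ => ((k : ℝ) + 1) * (max 0 (sNum C (k + 1) - 2 * ε)) ^ p) (𝓝[>] 0)
      (𝓝 (((k : ℝ) + 1) * (max 0 (sNum C (k + 1) - 2 * 0)) ^ p)) := by
    apply Tendsto.mono_left _ nhdsWithin_le_nhds
    apply Continuous.tendsto
    fun_prop
  rw [mul_zero, sub_zero, max_eq_right (sNum_nonneg _ _)] at hlim
  refine le_of_tendsto hlim ?_
  filter_upwards [self_mem_nhdsWithin] with ε hε
  obtain ⟨s, hs, h1, h2⟩ := key ε hε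
  refine le_trans ?_ h2
  gcongr
  exact max_le hs (by linarith)

end Approx

lemma slow_lower {b : ℝ} {L : ℝ → ℝ} (hL : SlowlyVarying b L) (s : ℝ) (hs : 0 < s) :
    ∃ c > 0, ∀ᶠ x : ℝ in atTop, c ≤ L x * x ^ s := by
  have hev : ∀ᶠ x : ℝ in atTop, -s < x * deriv L x / L x := hL.slow.eventually_const_lt (by linarith)
  obtain ⟨x₁, hx₁⟩ := eventually_atTop.1 hev
  set x₀ := max x₁ (b + 1) with hx₀
  have hb := hL.b_pos
  have h0b : b < x₀ := lt_of_lt_of_le (by linarith) (le_max_right _ _)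
  have hx0 : 0 < x₀ := hb.trans h0b
  have hder : ∀ x, b < x → HasDerivAt (fun x => L x * x ^ s)
      (deriv L x * x ^ s + L x * (s * x ^ (s - 1))) x := by
    intro x hx
    have h1 : DifferentiableAt ℝ L x :=
      (hL.contDiff.differentiableOn one_ne_zero).differentiableAt (Ici_mem_nhds hx)
    exact h1.hasDerivAt.mul (Real.hasDerivAt_rpow_const (Or.inl (hb.trans hx).ne'))
  have hmono : MonotoneOn (fun x => L x * x ^ s) (Set.Ici x₀) := by
    apply monotoneOn_of_deriv_nonneg (convex_Ici _)
    · intro x hx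
      exact (hder x (h0b.trans_le hx)).continuousAt.continuousWithinAt
    · intro x hx
      rw [interior_Ici] at hx
      exact (hder x (h0b.trans hx)).differentiableAt.differentiableWithinAt
    · intro x hx
      rw [interior_Ici] at hx
      have hxb : b < x := h0b.trans hx
      have hx00 : 0 < x := hb.trans hxb
      rw [(hder x hxb).deriv]
      have h1 := hx₁ x ((le_max_left _ _).trans (le_of_lt hx))
      have hLx := hL.pos x hxb.le
      rw [lt_div_iff₀ hLx] at h1
      have h2 : x ^ s = x ^ (s - 1) * x := by
        rw [← Real.rpow_add_one hx00.ne']; ring_nf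
      rw [h2]
      have h3 : 0 < x ^ (s - 1) := Real.rpow_pos_of_pos hx00 _
      have : deriv L x * (x ^ (s - 1) * x) + L x * (s * x ^ (s - 1)) =
        x ^ (s - 1) * (x * deriv L x + s * L x) := by ring
      rw [this]
      apply mul_nonneg h3.le
      linarith
  refine ⟨L x₀ * x₀ ^ s, mul_pos (hL.pos _ h0b.le) (Real.rpow_pos_of_pos hx0 _), ?_⟩
  filter_upwards [eventually_ge_atTop x₀] with x hx
  exact hmono (Set.mem_Ici.2 le_rfl) hx hx

lemma bounded_power_sums (f : ℕ → ℝ) (hf : ∀ n, 0 ≤ f n) (q : ℝ) (hq : 0 < q)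
    (h : Summable fun n => f n ^ q) (p : ℕ) (hp : q ≤ p) :
    ∃ M, ∀ n, ∑ k ∈ Finset.range n, f k ^ p ≤ M := by
  have hs : Summable fun n => f n ^ p := by
    refine Summable.of_norm_bounded_eventually_nat h ?_
    filter_upwards [h.tendsto_atTop_zero.eventually_lt_const zero_lt_one] with n hn
    have h1 : f n ≤ 1 := by
      by_contra hc
      push Not at hc
      exact absurd (Real.one_lt_rpow hc hq) (not_lt.2 hn.le)
    rw [Real.norm_of_nonneg (pow_nonneg (hf n) _), ← Real.rpow_natCast]
    exact Real.rpow_le_rpow_of_exponent_ge' (hf n) h1 hq.le hp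
  exact ⟨_, fun n => hs.sum_le_tsum _ fun k _ => pow_nonneg (hf k) _⟩

/-- **Theorem 2.3.** If `A = C + T` is compact, `C` non-negative compact with
`s n (C) / L n → a` for a slowly varying `L` and `0 < a < ∞`, and `T ∈ S_q` for some
`q > 0`, then `A` cannot be Volterra, i.e. `A` has a nonzero eigenvalue. -/
theorem statement1 {H : Type*} [NormedAddCommGroup H] [InnerProductSpace ℂ H]
    [CompleteSpace H] (A C T : H →L[ℂ] H) (hA : A = C + T)
    (hAcompact : IsCompactOperator (⇑A))
    (hCcompact : IsCompactOperator (⇑C)) (hCpos : C.IsPositive)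
    (hTcompact : IsCompactOperator (⇑T))
    (b : ℝ) (L : ℝ → ℝ) (hL : SlowlyVarying b L)
    (a q : ℝ) (ha0 : 0 < a) (hq0 : 0 < q)
    (hC : Tendsto (fun n : ℕ => sNum C n / L n) atTop (𝓝 a))
    (hT : Summable (fun n : ℕ => sNum T (n + 1) ^ q)) :
    ∃ μ : ℂ, μ ≠ 0 ∧ Module.End.HasEigenvalue (A : H →ₗ[ℂ] H) μ := by
  by_contra hcon
  push Not at hcon
  subst hA
  have hno : ∀ (μ : ℂ) (v : H), μ ≠ 0 → v ≠ 0 → (C + T) v ≠ μ • v := by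
    intro μ v hμ hv hev
    refine hcon μ hμ ?_
    exact Module.End.hasEigenvalue_of_hasEigenvector (x := v)
      ⟨Module.End.mem_eigenspace_iff.2 hev, hv⟩
  obtain ⟨m, hm⟩ := pow_unbounded_of_one_lt q (one_lt_two (α := ℝ))
  set p := 2 ^ (m + 1) with hp
  have hp1 : 0 < p := by positivity
  have hpR : (0 : ℝ) < p := by exact_mod_cast hp1
  have hqp : q ≤ (p : ℝ) := by
    rw [hp]; push_cast
    rw [pow_succ]
    have : (0 : ℝ) < 2 ^ m := by positivity
    linarith
  obtain ⟨M, hM⟩ := bounded_power_sums (fun n => sNum T (n + 1)) (fun n => sNum_nonneg _ _) q hq0 hT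
    p hqp
  obtain ⟨K, hK⟩ := sNum_bound_of_noeig m C T hAcompact hCcompact hCpos.isSelfAdjoint hno M hM
  obtain ⟨c, hc, hcL⟩ := slow_lower hL (1 / (2 * p)) (by positivity)
  have hev1 := tendsto_natCast_atTop_atTop (R := ℝ) |>.eventually hcL
  have hev2 := hC.eventually_const_lt (show a / 2 < a by linarith)
  have hev3 := tendsto_natCast_atTop_atTop (R := ℝ) |>.eventually (eventually_ge_atTop b)
  set c' := a / 2 * c with hc'
  have hc'0 : 0 < c' := by positivity
  have hev4 : ∀ᶠ n : ℕ in atTop, (n : ℝ) ≤ (K / c' ^ p) ^ 2 := by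
    filter_upwards [hev1, hev2, hev3, eventually_ge_atTop 1] with n h1 h2 h3 h4
    have hn : (0 : ℝ) < n := by exact_mod_cast h4
    have hLn := hL.pos _ h3
    rw [lt_div_iff₀ hLn] at h2
    have h5 : c' ≤ sNum C n * (n : ℝ) ^ (1 / (2 * p : ℝ)) := by
      have h6 : 0 < (n : ℝ) ^ (1 / (2 * p : ℝ)) := Real.rpow_pos_of_pos hn _
      calc c' ≤ a / 2 * (L n * (n : ℝ) ^ (1 / (2 * p : ℝ))) := by rw [hc']; gcongr
        _ = (a / 2 * L n) * (n : ℝ) ^ (1 / (2 * p : ℝ)) := by ring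
        _ ≤ _ := by gcongr
    have h7 : c' ^ p ≤ sNum C n ^ p * √n := by
      have := pow_le_pow_left₀ hc'0.le h5 p
      rw [mul_pow (sNum C n), ← Real.rpow_natCast ((n : ℝ) ^ (1 / (2 * p : ℝ))), ← Real.rpow_mul hn.le] at this
      have hpe : (1 / (2 * p : ℝ)) * (p : ℝ) = 1 / 2 := by
        have hp0 : (p : ℝ) ≠ 0 := by
          intro h0
          have : p = 0 := by exact_mod_cast h0
          omega
        field_simp
      rw [hpe] at this
      rw [Real.sqrt_eq_rpow]
      exact this
    obtain ⟨k, rfl⟩ : ∃ k, n = k + 1 := ⟨n - 1, by omega⟩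
    have h8 := hK k
    push_cast at *
    set x : ℝ := (k : ℝ) + 1
    have hsq : √x * √x = x := Real.mul_self_sqrt hn.le
    have hsp : 0 < √x := Real.sqrt_pos.2 hn
    have h9 : √x * c' ^ p ≤ K := by
      calc √x * c' ^ p ≤ √x * (sNum C (k + 1) ^ p * √x) := by gcongr
        _ = x * sNum C (k + 1) ^ p := by rw [← hsq]; ring_nf; simp
        _ ≤ K := h8
    have h10 : √x ≤ K / c' ^ p := by rwa [le_div_iff₀ (by positivity)]
    rw [← hsq, ← sq]
    gcongr
  have hev5 := tendsto_natCast_atTop_atTop (R := ℝ) |>.eventually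
    (eventually_gt_atTop ((K / c' ^ p) ^ 2))
  obtain ⟨n, h1, h2⟩ := (hev4.and hev5).exists
  linarith
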